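/- (Lemma in the proof of Proposition 3.8.) Let a ∈ (ℂ^×)^n. Suppose that for every Laurent polynomial ψ ∈ ℂ[z₁^{±1},…,z_n^{±1}] one has ∫_{(S¹)^{n−m}} [D_λ( p̃(λ) · p_{a⊙u}(λ) · ψ_{a⊙u}(λ) )]_{λ=0} du = 0. Then for every u ∈ (S¹)^{n−m} and every Laurent polynomial ψ ∈ ℂ[z₁^{±1},…,z_n^{±1}] one has [D_λ( p̃(λ) · p_{a⊙u}(λ) · ψ_{a⊙u}(λ) )]_{λ=0} = 0. -/

import Mathlib

open MeasureTheory

/-- Evaluation of a Laurent polynomial (a finitely supported family of coefficients indexed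
by `ℤⁿ`) at a point of `ℂⁿ` with nonzero coordinates (using `zpow` on the field `ℂ`). -/
noncomputable def laurentEvalC {n : ℕ} (f : (Fin n → ℤ) →₀ ℂ) (z : Fin n → ℂ) : ℂ :=
  f.sum fun e c => c * ∏ i, z i ^ e i

/-- The point `b ⊙ e(λ)` of `ℂⁿ`: its `j`-th coordinate is `b j · exp(λ j · log q)` for
`j < m` and `b j` for `m ≤ j`. -/
noncomputable def emap {n : ℕ} (m : ℕ) (q : ℝ) (b : Fin n → ℂ) (lam : Fin m → ℂ) :
    Fin n → ℂ :=
  fun j => if h : (j : ℕ) < m then b j * Complex.exp (lam ⟨j, h⟩ * Real.log q) else b j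

/-- The partial derivative of `f : ℂᵐ → ℂ` in the `i`-th coordinate direction. -/
noncomputable def pderivC {m : ℕ} (i : Fin m) (f : (Fin m → ℂ) → ℂ) : (Fin m → ℂ) → ℂ :=
  fun x => fderiv ℂ f x (Pi.single i 1)

/-- The iterated partial derivative `∂^β` of `f : ℂᵐ → ℂ` for a multi-index `β ∈ ℕᵐ`. -/
noncomputable def mderiv {m : ℕ} (β : Fin m → ℕ) (f : (Fin m → ℂ) → ℂ) :
    (Fin m → ℂ) → ℂ :=
  (List.finRange m).foldr (fun i g => (pderivC i)^[β i] g) f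

/-- The point `a ⊙ u` of `ℂⁿ`, where `u ∈ (S¹)^{n-m}` is parametrized by
`t ∈ ℝ^{n-m}` via `u_j = exp(2πi t_j)`: its `j`-th coordinate is `a j` for `j < m` and
`a j · exp(2πi t_{j-m})` for `m ≤ j`. -/
noncomputable def adotu {n : ℕ} (m : ℕ) (a : Fin n → ℂ) (t : Fin (n - m) → ℝ) :
    Fin n → ℂ :=
  fun j => if h : (j : ℕ) < m then a j
    else a j * Complex.exp (2 * Real.pi * Complex.I *
      (t ⟨(j : ℕ) - m, by have := j.isLt; omega⟩))

/-- An operator on functions is linear on germs at `x` if it maps germs of analytic functions to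
such germs and commutes with finite linear combinations of them. -/
def IsGermLinear {m : ℕ} (x : Fin m → ℂ)
    (T : ((Fin m → ℂ) → ℂ) → ((Fin m → ℂ) → ℂ)) : Prop :=
  (∀ f, AnalyticAt ℂ f x → AnalyticAt ℂ (T f) x) ∧
  (∀ f g, f =ᶠ[nhds x] g → T f =ᶠ[nhds x] T g) ∧
  (∀ (ι : Type) (s : Finset ι) (c : ι → ℂ) (f : ι → (Fin m → ℂ) → ℂ),
    (∀ i ∈ s, AnalyticAt ℂ (f i) x) →
      T (fun y => ∑ i ∈ s, c i * f i y) =ᶠ[nhds x] fun y => ∑ i ∈ s, c i * T (f i) y)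

theorem IsGermLinear.id {m : ℕ} (x : Fin m → ℂ) : IsGermLinear x (fun f => f) :=
  ⟨fun _ h => h, fun _ _ h => h, fun _ _ _ _ _ => Filter.EventuallyEq.rfl⟩

theorem IsGermLinear.comp {m : ℕ} {x : Fin m → ℂ}
    {S T : ((Fin m → ℂ) → ℂ) → ((Fin m → ℂ) → ℂ)}
    (hS : IsGermLinear x S) (hT : IsGermLinear x T) : IsGermLinear x (fun f => S (T f)) :=
  ⟨fun f h => hS.1 _ (hT.1 f h), fun f g h => hS.2.1 _ _ (hT.2.1 f g h),
    fun ι s c f h => (hS.2.1 _ _ (hT.2.2 ι s c f h)).trans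
      (hS.2.2 ι s c (fun i => T (f i)) fun i hi => hT.1 _ (h i hi))⟩

theorem IsGermLinear.iterate {m : ℕ} {x : Fin m → ℂ}
    {T : ((Fin m → ℂ) → ℂ) → ((Fin m → ℂ) → ℂ)}
    (hT : IsGermLinear x T) (k : ℕ) : IsGermLinear x (T^[k]) := by
  induction k with
  | zero => exact IsGermLinear.id x
  | succ k ih => exact ih.comp hT

theorem isGermLinear_pderivC {m : ℕ} (x : Fin m → ℂ) (i : Fin m) :
    IsGermLinear x (pderivC i) := by
  refine ⟨fun f h => ?_, fun f g h => ?_, fun ι s c f h => ?_⟩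
  · exact ((ContinuousLinearMap.apply ℂ ℂ (Pi.single i 1 : Fin m → ℂ)).analyticAt _).comp h.fderiv
  · filter_upwards [h.fderiv (𝕜 := ℂ)] with y hy
    simp only [pderivC, hy]
  · have hev : ∀ᶠ y in nhds x, ∀ i ∈ s, AnalyticAt ℂ (f i) y :=
      (Filter.eventually_all_finset s).2 fun i hi => (h i hi).eventually_analyticAt
    filter_upwards [hev] with y hy
    have hd : HasFDerivAt (fun y => ∑ i ∈ s, c i * f i y) (∑ i ∈ s, c i • fderiv ℂ (f i) y) y :=
      HasFDerivAt.fun_sum fun i hi => ((hy i hi).differentiableAt.hasFDerivAt).const_mul (c i)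
    simp [pderivC, hd.fderiv]

theorem isGermLinear_mderiv {m : ℕ} (x : Fin m → ℂ) (β : Fin m → ℕ) :
    IsGermLinear x (mderiv β) := by
  unfold mderiv
  induction List.finRange m with
  | nil => exact IsGermLinear.id x
  | cons i l ih => exact ((isGermLinear_pderivC x i).iterate (β i)).comp ih

theorem sum_mul_mderiv_sum {m : ℕ} {ι : Type} (x : Fin m → ℂ) (B : Finset (Fin m → ℕ))
    (c : (Fin m → ℕ) → ℂ) (s : Finset ι) (d : ι → ℂ) (f : ι → (Fin m → ℂ) → ℂ)
    (hf : ∀ i ∈ s, AnalyticAt ℂ (f i) x) :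
    ∑ β ∈ B, c β * mderiv β (fun y => ∑ i ∈ s, d i * f i y) x =
      ∑ i ∈ s, d i * ∑ β ∈ B, c β * mderiv β (f i) x := by
  simp_rw [((isGermLinear_mderiv x _).2.2 ι s d f hf).self_of_nhds, Finset.mul_sum]
  rw [Finset.sum_comm]
  exact Finset.sum_congr rfl fun _ _ => Finset.sum_congr rfl fun _ _ => by ring

theorem sum_mul_mderiv_const_mul {m : ℕ} (x : Fin m → ℂ) (B : Finset (Fin m → ℕ))
    (c : (Fin m → ℕ) → ℂ) (d : ℂ) (f : (Fin m → ℂ) → ℂ) (hf : AnalyticAt ℂ f x) :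
    ∑ β ∈ B, c β * mderiv β (fun y => d * f y) x = d * ∑ β ∈ B, c β * mderiv β f x := by
  simpa using sum_mul_mderiv_sum x B c {()} (fun _ => d) (fun _ => f) fun _ _ => hf

/-- The character `t ↦ exp(2πi⟨k, t⟩)` of the torus. -/
noncomputable def torusChar {d : ℕ} (k : Fin d → ℤ) (t : Fin d → ℝ) : ℂ :=
  ∏ j, Complex.exp (2 * Real.pi * Complex.I * t j) ^ k j

theorem torusChar_add {d : ℕ} (k l : Fin d → ℤ) (t : Fin d → ℝ) :
    torusChar (k + l) t = torusChar k t * torusChar l t := by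
  simp [torusChar, ← Finset.prod_mul_distrib, zpow_add₀]

theorem continuous_torusChar {d : ℕ} (k : Fin d → ℤ) : Continuous (torusChar k) := by
  unfold torusChar
  simp only [← Complex.exp_int_mul]
  fun_prop

theorem setIntegral_exp_zpow (k : ℤ) :
    ∫ t in Set.Ioc (0 : ℝ) 1, Complex.exp (2 * Real.pi * Complex.I * t) ^ k =
      if k = 0 then 1 else 0 := by
  rw [← intervalIntegral.integral_of_le zero_le_one]
  split_ifs with h
  · simp [h]
  · have hc : (k : ℂ) * (2 * Real.pi * Complex.I) ≠ 0 :=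
      mul_ne_zero (by exact_mod_cast h) Complex.two_pi_I_ne_zero
    simp only [← Complex.exp_int_mul, ← mul_assoc (k : ℂ) (2 * Real.pi * Complex.I)]
    rw [integral_exp_mul_complex hc]
    simp [Complex.exp_int_mul_two_pi_mul_I]

theorem setIntegral_torusChar {d : ℕ} (k : Fin d → ℤ) :
    ∫ t in (Set.univ.pi fun _ : Fin d => Set.Ioc (0 : ℝ) 1), torusChar k t =
      if k = 0 then 1 else 0 := by
  rw [volume_pi, Measure.restrict_pi_pi]
  simp only [torusChar]
  rw [integral_fintype_prod_eq_prod
    (f := fun (j : Fin d) (s : ℝ) => Complex.exp (2 * Real.pi * Complex.I * s) ^ k j)]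
  simp_rw [setIntegral_exp_zpow, Finset.prod_ite_zero, funext_iff]
  simp

theorem integrableOn_torusChar {d : ℕ} (k : Fin d → ℤ) :
    IntegrableOn (torusChar k) (Set.univ.pi fun _ : Fin d => Set.Ioc (0 : ℝ) 1) :=
  ((continuous_torusChar k).continuousOn.integrableOn_compact
    (isCompact_univ_pi fun _ => isCompact_Icc (a := (0 : ℝ)) (b := 1))).mono_set
    (Set.pi_mono fun _ _ => Set.Ioc_subset_Icc_self)

/-- A trigonometric polynomial all of whose Fourier coefficients vanish is zero. -/
theorem sum_torusChar_eq_zero {d : ℕ} {ι : Type*} (s : Finset ι) (C : ι → ℂ)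
    (k : ι → Fin d → ℤ)
    (h : ∀ l : Fin d → ℤ, ∫ t in (Set.univ.pi fun _ : Fin d => Set.Ioc (0 : ℝ) 1),
      torusChar (-l) t * ∑ x ∈ s, C x * torusChar (k x) t = 0) (t : Fin d → ℝ) :
    ∑ x ∈ s, C x * torusChar (k x) t = 0 := by
  classical
  have hcoeff : ∀ l, ∑ x ∈ s with k x = l, C x = 0 := fun l => by
    rw [← h l]
    have : ∀ t, torusChar (-l) t * ∑ x ∈ s, C x * torusChar (k x) t =
        ∑ x ∈ s, C x * torusChar (k x - l) t := fun t => by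
      rw [Finset.mul_sum]
      exact Finset.sum_congr rfl fun x _ => by rw [sub_eq_add_neg, torusChar_add]; ring
    simp_rw [this]
    rw [integral_finsetSum _ fun x _ => (integrableOn_torusChar (k x - l)).const_mul (C x)]
    simp_rw [integral_const_mul, setIntegral_torusChar, sub_eq_zero, mul_ite, mul_one, mul_zero]
    rw [Finset.sum_filter]
  rw [← Finset.sum_fiberwise_of_maps_to (g := k) (t := s.image k)
    fun x hx => Finset.mem_image_of_mem k hx]
  refine Finset.sum_eq_zero fun l _ => ?_
  rw [Finset.sum_congr rfl fun x hx => by rw [(Finset.mem_filter.1 hx).2], ← Finset.sum_mul,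
    hcoeff, zero_mul]

/-- The last `n - m` entries of an exponent vector. -/
def tailExp {n : ℕ} (m : ℕ) (f : Fin n → ℤ) (j : Fin (n - m)) : ℤ :=
  f ⟨m + j, by have := j.isLt; omega⟩

/-- The monomial with exponent `f` in the variables `exp(λ i · log q)`. -/
noncomputable def expMonomial {n m : ℕ} (hnm : m ≤ n) (q : ℝ) (f : Fin n → ℤ)
    (lam : Fin m → ℂ) : ℂ :=
  ∏ i : Fin m, Complex.exp (lam i * Real.log q) ^ f (Fin.castLE hnm i)

theorem analyticAt_expMonomial {n m : ℕ} (hnm : m ≤ n) (q : ℝ) (f : Fin n → ℤ)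
    (x : Fin m → ℂ) : AnalyticAt ℂ (expMonomial hnm q f) x := by
  have h : expMonomial hnm q f =
      fun lam => Complex.exp (∑ i, f (Fin.castLE hnm i) * (lam i * Real.log q)) := by
    ext lam
    simp [expMonomial, ← Complex.exp_int_mul, Complex.exp_sum]
  rw [h]
  have (i : Fin m) : AnalyticAt ℂ (fun lam : Fin m → ℂ => lam i) x :=
    (ContinuousLinearMap.proj (R := ℂ) (φ := fun _ : Fin m => ℂ) i).analyticAt x
  exact (Finset.analyticAt_fun_sum _ fun i _ =>
    analyticAt_const.mul ((this i).mul analyticAt_const)).cexp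

theorem prod_emap_adotu_zpow {n m : ℕ} (hnm : m ≤ n) (q : ℝ) (a : Fin n → ℂ)
    (t : Fin (n - m) → ℝ) (lam : Fin m → ℂ) (f : Fin n → ℤ) :
    ∏ j, emap m q (adotu m a t) lam j ^ f j =
      (∏ j, a j ^ f j) * torusChar (tailExp m f) t * expMonomial hnm q f lam := by
  have h : m + (n - m) = n := by omega
  rw [← Fin.prod_congr' _ h, ← Fin.prod_congr' (fun j => a j ^ f j) h, Fin.prod_univ_add,
    Fin.prod_univ_add]
  have h1 : ∀ i : Fin m, emap m q (adotu m a t) lam (Fin.cast h (Fin.castAdd (n - m) i)) =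
      a (Fin.cast h (Fin.castAdd (n - m) i)) * Complex.exp (lam i * Real.log q) := fun i => by
    simp [emap, adotu]
  have h2 : ∀ i : Fin (n - m), emap m q (adotu m a t) lam (Fin.cast h (Fin.natAdd m i)) =
      a (Fin.cast h (Fin.natAdd m i)) * Complex.exp (2 * Real.pi * Complex.I * t i) := fun i => by
    simp [emap, adotu]
  simp_rw [h1, h2, mul_zpow, Finset.prod_mul_distrib]
  have h3 : ∏ i : Fin m, Complex.exp (lam i * Real.log q) ^
      f (Fin.cast h (Fin.castAdd (n - m) i)) = expMonomial hnm q f lam := rfl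
  have h4 : ∏ i : Fin (n - m), Complex.exp (2 * Real.pi * Complex.I * t i) ^
      f (Fin.cast h (Fin.natAdd m i)) = torusChar (tailExp m f) t := rfl
  rw [h3, h4]
  ring

theorem emap_adotu_ne_zero {n m : ℕ} (q : ℝ) {a : Fin n → ℂ} (ha : ∀ j, a j ≠ 0)
    (t : Fin (n - m) → ℝ) (lam : Fin m → ℂ) (j : Fin n) :
    emap m q (adotu m a t) lam j ≠ 0 := by
  unfold emap adotu
  split_ifs <;> simp [ha j]

theorem laurentEvalC_mul_laurentEvalC {n : ℕ} (p ψ : (Fin n → ℤ) →₀ ℂ) {z : Fin n → ℂ}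
    (hz : ∀ j, z j ≠ 0) :
    laurentEvalC p z * laurentEvalC ψ z =
      ∑ x ∈ p.support ×ˢ ψ.support, p x.1 * ψ x.2 * ∏ j, z j ^ (x.1 + x.2) j := by
  simp only [laurentEvalC, Finsupp.sum, Finset.sum_mul_sum, Finset.sum_product]
  refine Finset.sum_congr rfl fun e _ => Finset.sum_congr rfl fun f _ => ?_
  simp only [Pi.add_apply, zpow_add₀ (hz _), Finset.prod_mul_distrib]
  ring

theorem laurentEvalC_mapDomain_add {n : ℕ} (ψ : (Fin n → ℤ) →₀ ℂ) (g : Fin n → ℤ)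
    {z : Fin n → ℂ} (hz : ∀ j, z j ≠ 0) :
    laurentEvalC (ψ.mapDomain (g + ·)) z = (∏ j, z j ^ g j) * laurentEvalC ψ z := by
  unfold laurentEvalC
  rw [Finsupp.sum_mapDomain_index (by simp) (by intros; ring), Finsupp.mul_sum]
  refine Finsupp.sum_congr fun f _ => ?_
  simp only [Pi.add_apply, zpow_add₀ (hz _), Finset.prod_mul_distrib]
  ring

theorem analyticAt_laurentEvalC_emap_adotu {n m : ℕ} (hnm : m ≤ n) (q : ℝ) (a : Fin n → ℂ)
    (t : Fin (n - m) → ℝ) (ψ : (Fin n → ℤ) →₀ ℂ) (x : Fin m → ℂ) :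
    AnalyticAt ℂ (fun lam => laurentEvalC ψ (emap m q (adotu m a t) lam)) x := by
  simp only [laurentEvalC, Finsupp.sum, prod_emap_adotu_zpow hnm]
  exact Finset.analyticAt_fun_sum _ fun f _ =>
    analyticAt_const.mul (analyticAt_const.mul (analyticAt_expMonomial hnm q f x))

/-- The exponent vector with last `n - m` entries `l` and all others zero. -/
def extendExp {n m : ℕ} (l : Fin (n - m) → ℤ) (j : Fin n) : ℤ :=
  if h : (j : ℕ) < m then 0 else l ⟨j - m, by have := j.isLt; omega⟩

/-- (Lemma in the proof of Proposition 3.8.) With `D = Σ_{β ∈ B} c_β ∂^β` a constant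
coefficient differential operator, `p` a Laurent polynomial and `p̃` holomorphic near `0`
with `p̃(0) ≠ 0`: if for every Laurent polynomial `ψ` the integral over `u ∈ (S¹)^{n-m}`
(with normalized Haar measure, parametrized by the unit cube) of
`[D_λ(p̃(λ)·p_{a⊙u}(λ)·ψ_{a⊙u}(λ))]_{λ=0}` vanishes, then for every `u` and every `ψ`
the quantity `[D_λ(p̃(λ)·p_{a⊙u}(λ)·ψ_{a⊙u}(λ))]_{λ=0}` itself vanishes. -/
theorem statement5 {n m : ℕ} (hm : 1 ≤ m) (hnm : m ≤ n)
    (q : ℝ) (hq : 1 < q)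
    (a : Fin n → ℂˣ)
    (B : Finset (Fin m → ℕ)) (c : (Fin m → ℕ) → ℂ)
    (p : (Fin n → ℤ) →₀ ℂ)
    (ptilde : (Fin m → ℂ) → ℂ)
    (hptilde : AnalyticAt ℂ ptilde 0) (hptilde0 : ptilde 0 ≠ 0)
    (hint : ∀ ψ : (Fin n → ℤ) →₀ ℂ,
      (∫ t in (Set.univ.pi fun _ : Fin (n - m) => Set.Ioc (0:ℝ) 1),
        ∑ β ∈ B, c β *
          mderiv β (fun lam =>
            ptilde lam *
            laurentEvalC p (emap m q (adotu m (fun j => (a j : ℂ)) t) lam) *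
            laurentEvalC ψ (emap m q (adotu m (fun j => (a j : ℂ)) t) lam)) 0) = 0) :
    ∀ (t : Fin (n - m) → ℝ) (ψ : (Fin n → ℤ) →₀ ℂ),
      ∑ β ∈ B, c β *
        mderiv β (fun lam =>
          ptilde lam *
          laurentEvalC p (emap m q (adotu m (fun j => (a j : ℂ)) t) lam) *
          laurentEvalC ψ (emap m q (adotu m (fun j => (a j : ℂ)) t) lam)) 0 = 0 := by
  intro t ψ
  set b : Fin n → ℂ := fun j => (a j : ℂ)
  have hb0 : ∀ j, b j ≠ 0 := fun j => (a j).ne_zero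
  set K : (Fin n → ℤ) → ℂ := fun g =>
    ∑ β ∈ B, c β * mderiv β (fun lam => ptilde lam * expMonomial hnm q g lam) 0
  have hexpand : ∀ t : Fin (n - m) → ℝ, ∑ β ∈ B, c β * mderiv β (fun lam => ptilde lam *
        laurentEvalC p (emap m q (adotu m b t) lam) *
        laurentEvalC ψ (emap m q (adotu m b t) lam)) 0 =
      ∑ x ∈ p.support ×ˢ ψ.support, p x.1 * ψ x.2 * (∏ j, b j ^ (x.1 + x.2) j) * K (x.1 + x.2) *
        torusChar (tailExp m (x.1 + x.2)) t := fun t => by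
    have hfun : (fun lam => ptilde lam * laurentEvalC p (emap m q (adotu m b t) lam) *
        laurentEvalC ψ (emap m q (adotu m b t) lam)) = fun lam =>
        ∑ x ∈ p.support ×ˢ ψ.support, (p x.1 * ψ x.2 * (∏ j, b j ^ (x.1 + x.2) j) *
          torusChar (tailExp m (x.1 + x.2)) t) *
          (ptilde lam * expMonomial hnm q (x.1 + x.2) lam) := by
      ext lam
      rw [mul_assoc, laurentEvalC_mul_laurentEvalC p ψ (emap_adotu_ne_zero q hb0 t lam),
        Finset.mul_sum]
      refine Finset.sum_congr rfl fun x _ => ?_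
      rw [prod_emap_adotu_zpow hnm]
      ring
    rw [hfun, sum_mul_mderiv_sum 0 B c _ _ _ fun x _ =>
      hptilde.fun_mul (analyticAt_expMonomial hnm q _ 0)]
    exact Finset.sum_congr rfl fun x _ => by ring
  rw [hexpand]
  refine sum_torusChar_eq_zero _ _ _ (fun l => ?_) t
  have hshift := hint (ψ.mapDomain (extendExp (-l) + ·))
  simp_rw [← hexpand]
  have htail : tailExp m (extendExp (n := n) (-l)) = -l := by
    ext j
    simp [tailExp, extendExp]
  have hone : ∀ lam, expMonomial hnm q (extendExp (-l)) lam = 1 := fun lam => by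
    simp [expMonomial, extendExp]
  have hfactor : ∀ t : Fin (n - m) → ℝ, ∑ β ∈ B, c β * mderiv β (fun lam => ptilde lam *
        laurentEvalC p (emap m q (adotu m b t) lam) *
        laurentEvalC (ψ.mapDomain (extendExp (-l) + ·)) (emap m q (adotu m b t) lam)) 0 =
      (∏ j, b j ^ extendExp (-l) j) * (torusChar (-l) t *
        ∑ β ∈ B, c β * mderiv β (fun lam => ptilde lam *
          laurentEvalC p (emap m q (adotu m b t) lam) *
          laurentEvalC ψ (emap m q (adotu m b t) lam)) 0) := fun t => by
    rw [← mul_assoc, ← sum_mul_mderiv_const_mul 0 B c _ _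
      ((hptilde.fun_mul (analyticAt_laurentEvalC_emap_adotu hnm q b t p 0)).fun_mul
        (analyticAt_laurentEvalC_emap_adotu hnm q b t ψ 0))]
    congr! 4 with β _ lam
    rw [laurentEvalC_mapDomain_add _ _ (emap_adotu_ne_zero q hb0 t lam),
      prod_emap_adotu_zpow hnm, htail, hone]
    ring
  simp_rw [hfactor, integral_const_mul] at hshift
  exact (mul_eq_zero.1 hshift).resolve_left
    (Finset.prod_ne_zero_iff.2 fun j _ => zpow_ne_zero _ (hb0 j))
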